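/- Let B be a translation invariant differentiation basis on ℝ², let f ∈ L¹(ℝ²) be finite everywhere with support contained in (0,1)², and let ε > 0 and α ∈ (0,1]. Then the set W_B(f,ε,α) = {γ ∈ Γ₂ : the Lebesgue outer measure of {x ∈ ℝ² : l_{B(γ)}(f)(x) ≥ ε} is at least α} is of type G_δ in Γ₂ (a countable intersection of open sets), where l_H(f)(x) = limsup over R ∈ H(x), diam R → 0, of |(1/|R|)∫_R f − f(x)|. -/

import Mathlib

open MeasureTheory Filter Set Topology

noncomputable section

/-- A differentiation basis on the plane (identified with `ℂ`): to each point `x` it assigns a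
family of bounded measurable sets of positive measure containing `x`, admitting a sequence of
sets whose diameters tend to `0`. -/
structure DiffBasis where
  sets : ℂ → Set (Set ℂ)
  bounded : ∀ x, ∀ R ∈ sets x, Bornology.IsBounded R
  measurable : ∀ x, ∀ R ∈ sets x, MeasurableSet R
  pos_measure : ∀ x, ∀ R ∈ sets x, 0 < volume R
  mem_self : ∀ x, ∀ R ∈ sets x, x ∈ R
  shrink : ∀ x, ∃ Rk : ℕ → Set ℂ, (∀ k, Rk k ∈ sets x) ∧
    Tendsto (fun k => Metric.diam (Rk k)) atTop (nhds 0)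

/-- Translation invariance of a differentiation basis. -/
def DiffBasis.TI (B : DiffBasis) : Prop :=
  ∀ x, B.sets x = (fun R => (fun y => x + y) '' R) '' B.sets 0

/-- The `γ`-rotated family of a set family: each `R ∈ S x` is rotated by `γ` around `x`. -/
def rotSets (S : ℂ → Set (Set ℂ)) (γ : Circle) : ℂ → Set (Set ℂ) :=
  fun x => (fun R => (fun y => x + (γ : ℂ) * (y - x)) '' R) '' S x

/-- The filter of "sets from the family with diameter tending to zero". -/
def basisFilter (F : Set (Set ℂ)) : Filter (Set ℂ) :=
  ⨅ r : {r : ℝ // 0 < r}, Filter.principal {R ∈ F | Metric.diam R < r.1}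

/-- The average `(1/|R|) ∫_R f`. -/
def avgI (f : ℂ → ℝ) (R : Set ℂ) : ℝ := (volume R).toReal⁻¹ * ∫ z in R, f z

/-- The upper derivative of `∫ f` with respect to the family `S` at `x`. -/
def upperD (S : ℂ → Set (Set ℂ)) (f : ℂ → ℝ) (x : ℂ) : EReal :=
  Filter.limsup (fun R => ((avgI f R : ℝ) : EReal)) (basisFilter (S x))

/-- The lower derivative of `∫ f` with respect to the family `S` at `x`. -/
def lowerD (S : ℂ → Set (Set ℂ)) (f : ℂ → ℝ) (x : ℂ) : EReal :=
  Filter.liminf (fun R => ((avgI f R : ℝ) : EReal)) (basisFilter (S x))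

/-- `∫ f` is differentiable with respect to the family `S`. -/
def Differentiates (S : ℂ → Set (Set ℂ)) (f : ℂ → ℝ) : Prop :=
  ∀ᵐ x : ℂ, upperD S f x = ((f x : ℝ) : EReal) ∧ lowerD S f x = ((f x : ℝ) : EReal)

/-- The open unit square `(0,1)²`. -/
def unitSquare : Set ℂ := {z | z.re ∈ Set.Ioo (0:ℝ) 1 ∧ z.im ∈ Set.Ioo (0:ℝ) 1}

/-- `l_H(f)(x)`: the limsup of `|(1/|R|)∫_R f − f(x)|` over `R ∈ H(x)` as `diam R → 0`. -/
def lH (S : ℂ → Set (Set ℂ)) (f : ℂ → ℝ) (x : ℂ) : EReal :=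
  Filter.limsup (fun R => ((|avgI f R - f x| : ℝ) : EReal)) (basisFilter (S x))

/-- The rigid motion `y ↦ x + γ y`. -/
def rigid (γ : Circle) (x : ℂ) : ℂ → ℂ := fun y => x + (γ : ℂ) * y

lemma rigid_isometry (γ : Circle) (x : ℂ) : Isometry (rigid γ x) := by
  refine Isometry.of_dist_eq fun a b => ?_
  simp only [rigid, dist_eq_norm]
  rw [add_sub_add_left_eq_sub, ← mul_sub, norm_mul, Circle.norm_coe, one_mul]

lemma rigid_mp (γ : Circle) (x : ℂ) : MeasurePreserving (rigid γ x) volume volume := by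
  have h1 : MeasurePreserving (fun y : ℂ => x + y) volume volume :=
    measurePreserving_add_left volume x
  have h2 : MeasurePreserving (rotation γ) volume volume :=
    (rotation γ).measurePreserving
  exact h1.comp h2

lemma rigid_emb (γ : Circle) (x : ℂ) : MeasurableEmbedding (rigid γ x) :=
  (rigid_isometry γ x).isClosedEmbedding.measurableEmbedding

lemma avgI_rigid (f : ℂ → ℝ) (R : Set ℂ) (γ : Circle) (x : ℂ) :
    avgI f (rigid γ x '' R) = (volume R).toReal⁻¹ * ∫ y in R, f (rigid γ x y) := by
  unfold avgI
  rw [(rigid_mp γ x).setIntegral_image_emb (rigid_emb γ x)]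
  congr 3
  rw [← (rigid_mp γ x).measure_preimage_emb (rigid_emb γ x),
    preimage_image_eq _ (rigid_isometry γ x).injective]

lemma avgI_rigid_continuous (f : ℂ → ℝ) (hf : Integrable f) (R : Set ℂ)
    (hb : Bornology.IsBounded R) :
    Continuous fun p : Circle × ℂ => avgI f (rigid p.1 p.2 '' R) := by
  simp only [avgI_rigid]
  refine continuous_const.mul ?_
  refine continuous_of_uniform_approx_of_continuous ?_
  rw [Metric.uniformity_basis_dist_le.forall_iff (by
    rintro s t hst ⟨F, hF, h⟩
    exact ⟨F, hF, fun y => hst (h y)⟩)]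
  intro δ hδ
  obtain ⟨g, hgs, hfg, hgc, hgi⟩ := hf.exists_hasCompactSupport_integral_sub_le hδ
  obtain ⟨C, hC⟩ := hgc.bounded_above_of_compact_support hgs
  have hfin : volume R < ⊤ := hb.measure_lt_top
  have hcr : Continuous fun q : (Circle × ℂ) × ℂ => rigid q.1.1 q.1.2 q.2 := by
    unfold rigid; fun_prop
  refine ⟨fun p => ∫ y in R, g (rigid p.1 p.2 y), ?_, ?_⟩
  · refine continuous_of_dominated (bound := fun _ => C) ?_ ?_ ?_ ?_
    · intro p
      exact (hgc.comp (hcr.comp (Continuous.prodMk_right p))).aestronglyMeasurable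
    · intro p; exact ae_of_all _ fun y => hC _
    · exact integrableOn_const hfin.ne
    · exact ae_of_all _ fun y => hgc.comp (hcr.comp (Continuous.prodMk_left y))
  · rintro ⟨γ, x⟩
    have i1 : Integrable (fun y => f (rigid γ x y)) :=
      (rigid_mp γ x).integrable_comp_of_integrable hf
    have i2 : Integrable (fun y => g (rigid γ x y)) :=
      (rigid_mp γ x).integrable_comp_of_integrable hgi
    simp only [mem_ofPred_eq, dist_eq_norm]
    rw [← integral_sub i1.integrableOn i2.integrableOn]
    calc ‖∫ y in R, (f (rigid γ x y) - g (rigid γ x y))‖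
        ≤ ∫ y in R, ‖f (rigid γ x y) - g (rigid γ x y)‖ := norm_integral_le_integral_norm _
      _ ≤ ∫ y, ‖f (rigid γ x y) - g (rigid γ x y)‖ :=
          setIntegral_le_integral (i1.sub i2).norm (ae_of_all _ fun y => norm_nonneg _)
      _ = ∫ z, ‖f z - g z‖ :=
          (rigid_mp γ x).integral_comp (rigid_emb γ x) (fun z => ‖f z - g z‖)
      _ ≤ δ := hfg

lemma nullMeas_exists_lt {ι : Type*} (S : Set ι) (a : ι → ℂ → ℝ) (h : ℂ → ℝ)
    (ha : ∀ i ∈ S, Continuous (a i)) (hh : AEMeasurable h volume) :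
    NullMeasurableSet {x | ∃ i ∈ S, h x < a i x} volume := by
  have : {x | ∃ i ∈ S, h x < a i x} =
      ⋃ q : ℚ, (h ⁻¹' Iio (q : ℝ) ∩ ⋃ i ∈ S, (a i) ⁻¹' Ioi (q : ℝ)) := by
    ext x
    simp only [mem_ofPred_eq, mem_iUnion, mem_inter_iff, mem_preimage, mem_Iio, mem_Ioi,
      exists_prop]
    constructor
    · rintro ⟨i, hi, hlt⟩
      obtain ⟨q, h1, h2⟩ := exists_rat_btwn hlt
      exact ⟨q, h1, i, hi, h2⟩
    · rintro ⟨q, h1, i, hi, h2⟩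
      exact ⟨i, hi, h1.trans h2⟩
  rw [this]
  refine NullMeasurableSet.iUnion fun q => (hh.nullMeasurableSet_preimage measurableSet_Iio).inter ?_
  exact (isOpen_biUnion fun i hi => isOpen_Ioi.preimage (ha i hi)).measurableSet.nullMeasurableSet

/-- The approximating sets. -/
def Eset (B : DiffBasis) (f : ℂ → ℝ) (ε : ℝ) (k : ℕ) (γ : Circle) : Set ℂ :=
  {x | ∃ R ∈ {R ∈ B.sets 0 | Metric.diam R < 1 / ((k : ℝ) + 1)},
    ε - 1 / ((k : ℝ) + 1) < |avgI f (rigid γ x '' R) - f x|}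

lemma Eset_nullMeas (B : DiffBasis) (f : ℂ → ℝ) (hf : Integrable f) (ε : ℝ) (k : ℕ)
    (γ : Circle) : NullMeasurableSet (Eset B f ε k γ) volume := by
  set S := {R ∈ B.sets 0 | Metric.diam R < 1 / ((k : ℝ) + 1)} with hS
  set c := ε - 1 / ((k : ℝ) + 1) with hc
  have hcont : ∀ R ∈ S, Continuous fun x => avgI f (rigid γ x '' R) := fun R hR =>
    (avgI_rigid_continuous f hf R (B.bounded 0 R hR.1)).comp (Continuous.prodMk_right γ)
  have h1 := nullMeas_exists_lt S (fun R x => avgI f (rigid γ x '' R)) (fun x => c + f x)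
    hcont (hf.aemeasurable.const_add c)
  have h2 := nullMeas_exists_lt S (fun R x => - avgI f (rigid γ x '' R)) (fun x => c - f x)
    (fun R hR => (hcont R hR).neg) (hf.aemeasurable.const_sub c)
  convert h1.union h2 using 1
  ext x
  simp only [Eset, mem_ofPred_eq, mem_union, lt_abs]
  constructor
  · rintro ⟨R, hR, h | h⟩
    · exact Or.inl ⟨R, hR, by linarith⟩
    · exact Or.inr ⟨R, hR, by linarith⟩
  · rintro (⟨R, hR, h⟩ | ⟨R, hR, h⟩)
    · exact ⟨R, hR, Or.inl (by linarith)⟩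
    · exact ⟨R, hR, Or.inr (by linarith)⟩

lemma Eset_lsc (B : DiffBasis) (f : ℂ → ℝ) (hf : Integrable f) (ε : ℝ) (k : ℕ) :
    LowerSemicontinuous fun γ => volume (Eset B f ε k γ) := by
  intro γ
  refine lowerSemicontinuousAt_iff_le_liminf.2 ?_
  have hE : ∀ γ, volume (Eset B f ε k γ) =
      ∫⁻ x, (Eset B f ε k γ).indicator (fun _ => (1 : ENNReal)) x := fun γ => by
    rw [lintegral_indicator_const₀ (Eset_nullMeas B f hf ε k γ), one_mul]
  simp only [hE]
  refine le_trans (lintegral_mono fun x => ?_) (lintegral_liminf_le' fun γ' =>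
    aemeasurable_const.indicator₀ (Eset_nullMeas B f hf ε k γ'))
  by_cases hx : x ∈ Eset B f ε k γ
  · rw [indicator_of_mem hx]
    refine le_liminf_of_le (by isBoundedDefault) ?_
    obtain ⟨R, hR, hlt⟩ := hx
    have hc : Continuous fun γ' : Circle => |avgI f (rigid γ' x '' R) - f x| :=
      (((avgI_rigid_continuous f hf R (B.bounded 0 R hR.1)).comp
        (Continuous.prodMk_left x)).sub continuous_const).abs
    filter_upwards [hc.continuousAt.eventually (lt_mem_nhds hlt)] with γ' hγ'
    rw [indicator_of_mem (show x ∈ Eset B f ε k γ' from ⟨R, hR, hγ'⟩)]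
  · rw [indicator_of_notMem hx]
    exact zero_le

lemma Eset_antitone (B : DiffBasis) (f : ℂ → ℝ) (ε : ℝ) (γ : Circle) :
    Antitone fun k => Eset B f ε k γ := by
  rintro k l hkl x ⟨R, hR, h⟩
  have : 1 / ((l : ℝ) + 1) ≤ 1 / ((k : ℝ) + 1) := Nat.one_div_le_one_div hkl
  exact ⟨R, ⟨hR.1, hR.2.trans_le this⟩, by linarith⟩

lemma Eset_finite (B : DiffBasis) (f : ℂ → ℝ) (hsupp : Function.support f ⊆ unitSquare)
    (ε : ℝ) (hε : 0 < ε) (γ : Circle) : ∃ k, volume (Eset B f ε k γ) ≠ ⊤ := by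
  obtain ⟨k, hk⟩ := exists_nat_one_div_lt hε
  refine ⟨k, ?_⟩
  have hsub : Eset B f ε k γ ⊆ Metric.closedBall 0 3 := by
    rintro x ⟨R, hR, h⟩
    by_contra hx
    have hx3 : 3 < ‖x‖ := by simpa using hx
    have hz : ∀ z : ℂ, dist z x < 1 → f z = 0 := by
      intro z hz
      by_contra hfz
      have hm : z ∈ unitSquare := hsupp hfz
      obtain ⟨⟨h1, h2⟩, h3, h4⟩ := hm
      have := Complex.norm_le_abs_re_add_abs_im z
      rw [abs_of_pos h1, abs_of_pos h3] at this
      have h5 : ‖x‖ ≤ ‖z‖ + dist z x := by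
        rw [dist_comm, dist_eq_norm]
        calc ‖x‖ = ‖z + (x - z)‖ := by congr 1; ring
          _ ≤ _ := norm_add_le _ _
      linarith
    have hfx : f x = 0 := hz x (by simp)
    have hav : avgI f (rigid γ x '' R) = 0 := by
      rw [avgI_rigid]
      have : ∫ y in R, f (rigid γ x y) = 0 := by
        refine setIntegral_eq_zero_of_forall_eq_zero fun y hy => hz _ ?_
        have h0 : x = rigid γ x 0 := by simp [rigid]
        have h1 : dist (rigid γ x y) x = dist y 0 := by
          conv_lhs => rw [h0]
          rw [show rigid γ (rigid γ x 0) y = rigid γ x y by rw [← h0]]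
          exact (rigid_isometry γ x).dist_eq y 0
        rw [h1]
        refine (Metric.dist_le_diam_of_mem (B.bounded 0 R hR.1) hy (B.mem_self 0 R hR.1)).trans_lt
          (hR.2.trans_le ?_)
        rw [div_le_one (by positivity)]
        have : (0 : ℝ) ≤ k := Nat.cast_nonneg k
        linarith
      rw [this, mul_zero]
    rw [hav, hfx, sub_zero, abs_zero] at h
    linarith
  exact ((measure_mono hsub).trans_lt measure_closedBall_lt_top).ne

lemma basisFilter_hasBasis (F : Set (Set ℂ)) :
    (basisFilter F).HasBasis (fun _ : {r : ℝ // 0 < r} => True)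
      (fun r => {R ∈ F | Metric.diam R < r.1}) := by
  have : Nonempty {r : ℝ // 0 < r} := ⟨⟨1, one_pos⟩⟩
  refine hasBasis_iInf_principal ?_
  intro r s
  refine ⟨⟨min r.1 s.1, lt_min r.2 s.2⟩, ?_, ?_⟩
  · rintro R ⟨h1, h2⟩
    exact ⟨h1, h2.trans_le (min_le_left _ _)⟩
  · rintro R ⟨h1, h2⟩
    exact ⟨h1, h2.trans_le (min_le_right _ _)⟩

lemma rotSets_eq (B : DiffBasis) (hB : B.TI) (γ : Circle) (x : ℂ) :
    rotSets B.sets γ x = (fun R => rigid γ x '' R) '' B.sets 0 := by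
  unfold rotSets
  rw [hB x, image_image]
  refine image_congr fun R _ => ?_
  rw [image_image]
  refine image_congr fun y _ => ?_
  simp [rigid]

lemma level_eq (B : DiffBasis) (hB : B.TI) (f : ℂ → ℝ) (ε : ℝ) (γ : Circle) :
    {x : ℂ | (ε : EReal) ≤ lH (rotSets B.sets γ) f x} = ⋂ k, Eset B f ε k γ := by
  ext x
  simp only [mem_ofPred_eq, mem_iInter]
  unfold lH
  rw [le_limsup_iff]
  simp only [(basisFilter_hasBasis _).frequently_iff, rotSets_eq B hB]
  constructor
  · intro h k
    have hk : (0 : ℝ) < 1 / ((k : ℝ) + 1) := Nat.one_div_pos_of_nat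
    obtain ⟨Q, ⟨⟨R, hR, rfl⟩, hd⟩, hlt⟩ := h ((ε - 1 / ((k : ℝ) + 1) : ℝ) : EReal)
      (EReal.coe_lt_coe_iff.2 (by linarith)) ⟨_, hk⟩ trivial
    refine ⟨R, ⟨hR, ?_⟩, EReal.coe_lt_coe_iff.1 hlt⟩
    simpa only [(rigid_isometry γ x).diam_image] using hd
  · rintro h y hy ⟨r, hr⟩ -
    obtain ⟨z, hyz, hz⟩ := EReal.lt_iff_exists_real_btwn.1 hy
    have hz' : 0 < ε - z := sub_pos.2 (EReal.coe_lt_coe_iff.1 hz)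
    obtain ⟨k, hk⟩ := exists_nat_one_div_lt (lt_min hz' hr)
    obtain ⟨R, ⟨hR, hd⟩, hlt⟩ := h k
    have h1 := hk.trans_le (min_le_left _ _)
    have h2 := hk.trans_le (min_le_right _ _)
    refine ⟨_, ⟨⟨R, hR, rfl⟩, ?_⟩, hyz.trans (EReal.coe_lt_coe_iff.2 (by linarith))⟩
    simp only [(rigid_isometry γ x).diam_image]
    exact hd.trans h2

/-- for a translation invariant basis `B`, `f ∈ L¹` supported in `(0,1)²`, `ε > 0`
and `α ∈ (0,1]`, the set `W_B(f,ε,α)` of rotations `γ` for which the outer measure of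
`{l_{B(γ)}(f) ≥ ε}` is at least `α` is of type `G_δ` in `Γ₂`. -/
theorem W_eps_alpha_isGdelta (B : DiffBasis) (hB : B.TI) (f : ℂ → ℝ) (hf : Integrable f)
    (hsupp : Function.support f ⊆ unitSquare) (ε α : ℝ) (hε : 0 < ε)
    (hα : α ∈ Set.Ioc (0:ℝ) 1) :
    IsGδ {γ : Circle |
      ENNReal.ofReal α ≤ volume {x : ℂ | (ε : EReal) ≤ lH (rotSets B.sets γ) f x}} := by
  have hα' : (0 : ENNReal) < ENNReal.ofReal α := ENNReal.ofReal_pos.2 hα.1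
  obtain ⟨u, -, hu, hlim⟩ := exists_seq_strictMono_tendsto' hα'
  have key : {γ : Circle |
      ENNReal.ofReal α ≤ volume {x : ℂ | (ε : EReal) ≤ lH (rotSets B.sets γ) f x}} =
      ⋂ k : ℕ, ⋂ n : ℕ, (fun γ => volume (Eset B f ε k γ)) ⁻¹' Ioi (u n) := by
    ext γ
    simp only [mem_ofPred_eq, mem_iInter, mem_preimage, mem_Ioi]
    rw [level_eq B hB, (Eset_antitone B f ε γ).measure_iInter
      (fun k => Eset_nullMeas B f hf ε k γ) (Eset_finite B f hsupp ε hε γ), le_iInf_iff]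
    refine forall_congr' fun k => ⟨fun h n => (hu n).2.trans_le h, fun h => ?_⟩
    exact le_of_tendsto' hlim fun n => (h n).le
  rw [key]
  exact IsGδ.iInter fun k => IsGδ.iInter fun n =>
    ((Eset_lsc B f hf ε k).isOpen_preimage (u n)).isGδ

end
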